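/- Let n, m ≥ 2, let A ∈ ℝ^{n×m} have nonnegative entries with no zero row and no zero column, and let p ∈ ℝ^n, q ∈ ℝ^m have strictly positive entries with ∑_{i=1}^n p_i = ∑_{j=1}^m q_j. Suppose ε_p(A) > 0 and, setting w = V(A)/min_i p_i, suppose w < 1, ε_p(A) < (1+w)/(1−w), and 2w(1 + w·r(w, ε_p(A))) ≤ ε_p(A). Suppose moreover V(A) > 0 and that the constraint set C = {X ∈ ℝ^{n×m} : ∑_j x_{ij} = p_i for all i, ∑_i x_{ij} = q_j for all j, x_{ij} ≥ 0 for all (i,j), and x_{ij} = 0 whenever a_{ij} = 0} is nonempty, and let X* be the unique element of C minimizing ‖X − A‖₂ over C. Then there exists α ∈ (0,1) such that for every t ≥ 0 the iterates of the alternating balancing procedure satisfy ‖X^{(2t)} − X*‖₂² ≤ J(X*)²·δJ(X^{(2t)})·(2 + δJ(X^{(2t)})) + J(X*)·(4V(A)/α)·(1−α)^{2t}. -/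

import Mathlib

open Finset

/-- Lyapunov function `V(X) = ∑ᵢ |∑ⱼ xᵢⱼ − pᵢ| + ∑ⱼ |∑ᵢ xᵢⱼ − qⱼ|`. -/
noncomputable def lyap {n m : ℕ} (p : Fin n → ℝ) (q : Fin m → ℝ)
    (X : Matrix (Fin n) (Fin m) ℝ) : ℝ :=
  ∑ i, |(∑ j, X i j) - p i| + ∑ j, |(∑ i, X i j) - q j|

/-- Row-balancing step `X'ᵢⱼ = pᵢ xᵢⱼ / ∑ₗ xᵢₗ`. -/
noncomputable def rowBal {n m : ℕ} (p : Fin n → ℝ) (X : Matrix (Fin n) (Fin m) ℝ) :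
    Matrix (Fin n) (Fin m) ℝ :=
  fun i j => p i * X i j / ∑ l, X i l

/-- Column-balancing step `X''ᵢⱼ = qⱼ xᵢⱼ / ∑ₖ xₖⱼ`. -/
noncomputable def colBal {n m : ℕ} (q : Fin m → ℝ) (X : Matrix (Fin n) (Fin m) ℝ) :
    Matrix (Fin n) (Fin m) ℝ :=
  fun i j => q j * X i j / ∑ k, X k j

/-- Alternating balancing procedure: `X⁽⁰⁾ = A`, odd steps row-balance, even steps
column-balance. -/
noncomputable def iterBal {n m : ℕ} (p : Fin n → ℝ) (q : Fin m → ℝ)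
    (A : Matrix (Fin n) (Fin m) ℝ) : ℕ → Matrix (Fin n) (Fin m) ℝ
  | 0 => A
  | s + 1 => if s % 2 = 0 then rowBal p (iterBal p q A s) else colBal q (iterBal p q A s)

/-- `ε_p(X)`: minimum over nonempty proper subsets `Ĩ ⊊ {1,…,n}`, `J̃ ⊊ {1,…,m}` of
`min_{j∈J̃} ∑_{i∉Ĩ} xᵢⱼ/(∑ₖ xₖⱼ) + min_{j∉J̃} ∑_{i∈Ĩ} xᵢⱼ/(∑ₖ xₖⱼ)`. -/
noncomputable def epsP {n m : ℕ} (X : Matrix (Fin n) (Fin m) ℝ) : ℝ :=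
  sInf { v : ℝ | ∃ (I : Finset (Fin n)) (J : Finset (Fin m)),
    I.Nonempty ∧ I ≠ Finset.univ ∧ J.Nonempty ∧ J ≠ Finset.univ ∧
    v = sInf ((fun j => ∑ i ∈ Iᶜ, X i j / ∑ k, X k j) '' (J : Set (Fin m))) +
        sInf ((fun j => ∑ i ∈ I, X i j / ∑ k, X k j) '' ((Jᶜ : Finset (Fin m)) : Set (Fin m))) }

/-- `r(w, ε) = (4 − (1+ε)(1−w)²) / ((1 + εw − (1+ε)w²)(1−w))`. -/
noncomputable def rF (w ε : ℝ) : ℝ :=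
  (4 - (1 + ε) * (1 - w) ^ 2) / ((1 + ε * w - (1 + ε) * w ^ 2) * (1 - w))

/-- Frobenius norm. -/
noncomputable def frob {n m : ℕ} (X : Matrix (Fin n) (Fin m) ℝ) : ℝ :=
  Real.sqrt (∑ i, ∑ j, (X i j) ^ 2)

/-- Entrywise 1-norm `‖X‖₁ = ∑ᵢⱼ |xᵢⱼ|`. -/
noncomputable def norm1 {n m : ℕ} (X : Matrix (Fin n) (Fin m) ℝ) : ℝ :=
  ∑ i, ∑ j, |X i j|

/-- The analytic solution `X̂` of the problem with only the transport equality constraints. -/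
noncomputable def Xhat {n m : ℕ} (A : Matrix (Fin n) (Fin m) ℝ) (p : Fin n → ℝ)
    (q : Fin m → ℝ) : Matrix (Fin n) (Fin m) ℝ :=
  fun i j =>
    A i j - (1 / (m : ℝ)) * ((∑ l, A i l) - p i) - (1 / (n : ℝ)) * ((∑ k, A k j) - q j)
      + (1 / ((n : ℝ) * (m : ℝ))) * ((∑ k, ∑ l, A k l) - ∑ i, p i)

/-- Relative error by the objective function, `δJ(X) = (J(X) − J(X̂))/J(X̂)` with
`J(X) = ‖X − A‖₂`. -/
noncomputable def deltaJ {n m : ℕ} (A : Matrix (Fin n) (Fin m) ℝ) (p : Fin n → ℝ)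
    (q : Fin m → ℝ) (X : Matrix (Fin n) (Fin m) ℝ) : ℝ :=
  (frob (X - A) - frob (Xhat A p q - A)) / frob (Xhat A p q - A)

open Finset

def GoodP {n m : ℕ} (X : Matrix (Fin n) (Fin m) ℝ) (e : ℝ) : Prop :=
  ∀ (I : Finset (Fin n)) (j j' : Fin m),
    e ≤ ∑ i ∈ Iᶜ, X i j / ∑ k, X k j + ∑ i ∈ I, X i j' / ∑ k, X k j'

structure InvP {n m : ℕ} (A X : Matrix (Fin n) (Fin m) ℝ) : Prop where
  nn : ∀ i j, 0 ≤ X i j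
  row : ∀ i, 0 < ∑ j, X i j
  col : ∀ j, 0 < ∑ i, X i j
  supp : ∀ i j, A i j = 0 → X i j = 0

theorem sum_frac_one {n m : ℕ} (X : Matrix (Fin n) (Fin m) ℝ) (j : Fin m)
    (h : 0 < ∑ i, X i j) : ∑ i, X i j / ∑ k, X k j = 1 := by
  rw [← Finset.sum_div]; exact div_self h.ne'

theorem goodP_of_eps {n m : ℕ} (A : Matrix (Fin n) (Fin m) ℝ) (h : InvP A A) :
    GoodP A (min (epsP A) 1) := by
  intro I j j'
  have hnn : ∀ i j, 0 ≤ A i j / ∑ k, A k j := fun i j => div_nonneg (h.nn i j) (h.col j).le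
  by_cases hI : I = ∅
  · subst hI
    simp [sum_frac_one A j (h.col j)]
  by_cases hI' : I = univ
  · subst hI'
    simp [sum_frac_one A j' (h.col j')]
  by_cases hj : j = j'
  · subst hj
    have := Finset.sum_compl_add_sum I (fun i => A i j / ∑ k, A k j)
    rw [this, sum_frac_one A j (h.col j)]
    exact min_le_right _ _
  refine (min_le_left _ _).trans ?_
  have bdd : ∀ (K : Finset (Fin n)) (s : Set (Fin m)),
      BddBelow ((fun j => ∑ i ∈ K, A i j / ∑ k, A k j) '' s) := by
    intro K s
    refine ⟨0, ?_⟩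
    rintro _ ⟨x, _, rfl⟩
    exact Finset.sum_nonneg fun i _ => hnn i x
  have h0 : ∀ (K : Finset (Fin n)) (s : Set (Fin m)),
      0 ≤ sInf ((fun j => ∑ i ∈ K, A i j / ∑ k, A k j) '' s) := by
    intro K s
    apply Real.sInf_nonneg
    rintro _ ⟨x, _, rfl⟩
    exact Finset.sum_nonneg fun i _ => hnn i x
  unfold epsP
  refine le_trans (csInf_le (a := sInf ((fun j => ∑ i ∈ Iᶜ, A i j / ∑ k, A k j) ''
      (({j} : Finset (Fin m)) : Set (Fin m))) +
      sInf ((fun j => ∑ i ∈ I, A i j / ∑ k, A k j) ''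
      ((({j} : Finset (Fin m))ᶜ : Finset (Fin m)) : Set (Fin m)))) ?_
    ⟨I, {j}, Finset.nonempty_iff_ne_empty.2 hI, hI', by simp, ?_, rfl⟩) ?_
  · refine ⟨0, ?_⟩
    rintro _ ⟨I, J, -, -, -, -, rfl⟩
    exact add_nonneg (h0 _ _) (h0 _ _)
  · intro hh
    have : j' ∈ ({j} : Finset (Fin m)) := hh ▸ mem_univ j'
    exact hj (Finset.mem_singleton.1 this).symm
  · refine add_le_add (csInf_le (bdd _ _) ⟨j, by simp, rfl⟩) (csInf_le (bdd _ _) ⟨j', ?_, rfl⟩)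
    simp; exact fun hh => hj hh.symm

/-- Row scaling. -/
theorem goodP_scale {n m : ℕ} (X : Matrix (Fin n) (Fin m) ℝ) (e k : ℝ) (l : Fin n → ℝ)
    (hX : ∀ i j, 0 ≤ X i j) (hc : ∀ j, 0 < ∑ i, X i j)
    (hk : 0 ≤ k) (hl : ∀ i, 0 < l i) (hkl : ∀ i i', k * l i ≤ l i')
    (hc' : ∀ j, 0 < ∑ i, l i * X i j)
    (h : GoodP X e) : GoodP (fun i j => l i * X i j : Matrix (Fin n) (Fin m) ℝ) (k * e) := by
  intro I j j'
  have key : ∀ i j, k * (X i j / ∑ a, X a j) ≤ l i * X i j / ∑ a, l a * X a j := by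
    intro i j
    rw [mul_div_assoc', div_le_div_iff₀ (hc j) (hc' j)]
    have : k * ∑ a, l a * X a j ≤ l i * ∑ a, X a j := by
      rw [Finset.mul_sum, Finset.mul_sum]
      refine Finset.sum_le_sum fun a _ => ?_
      rw [← mul_assoc]
      exact mul_le_mul_of_nonneg_right (hkl a i) (hX a j)
    nlinarith [hX i j]
  calc k * e ≤ k * (∑ i ∈ Iᶜ, X i j / ∑ k, X k j + ∑ i ∈ I, X i j' / ∑ k, X k j') :=
        mul_le_mul_of_nonneg_left (h I j j') hk
    _ = ∑ i ∈ Iᶜ, k * (X i j / ∑ k, X k j) + ∑ i ∈ I, k * (X i j' / ∑ k, X k j') := by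
        rw [mul_add, Finset.mul_sum, Finset.mul_sum]
    _ ≤ _ := add_le_add (Finset.sum_le_sum fun i _ => key i j)
        (Finset.sum_le_sum fun i _ => key i j')

theorem goodP_colBal {n m : ℕ} (X : Matrix (Fin n) (Fin m) ℝ) (e : ℝ) (q : Fin m → ℝ)
    (hc : ∀ j, 0 < ∑ i, X i j) (hq : ∀ j, 0 < q j)
    (h : GoodP X e) : GoodP (colBal q X) e := by
  intro I j j'
  have key : ∀ i j, colBal q X i j / ∑ k, colBal q X k j = X i j / ∑ k, X k j := by
    intro i j
    have h1 : ∑ k, colBal q X k j = q j := by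
      simp only [colBal]
      rw [← Finset.sum_div, ← Finset.mul_sum, mul_div_assoc, div_self (hc j).ne', mul_one]
    rw [h1]
    have := (hc j).ne'
    have := (hq j).ne'
    simp only [colBal]
    field_simp
  simp only [key]
  exact h I j j'

theorem dobrushin {n m : ℕ} (X : Matrix (Fin n) (Fin m) ℝ) (e : ℝ)
    (hc : ∀ j, 0 < ∑ i, X i j) (h : GoodP X e) (d : Fin m → ℝ) (hd : ∑ j, d j = 0) :
    ∑ i, |∑ j, X i j / (∑ k, X k j) * d j| ≤ (1 - e) * ∑ j, |d j| := by
  set Q : Fin n → Fin m → ℝ := fun i j => X i j / ∑ k, X k j with hQ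
  have hQ1 : ∀ j, ∑ i, Q i j = 1 := fun j => sum_frac_one X j (hc j)
  set y : Fin n → ℝ := fun i => ∑ j, Q i j * d j with hy
  have hy0 : ∑ i, y i = 0 := by
    simp only [hy]
    rw [Finset.sum_comm]
    simp only [← Finset.sum_mul, hQ1, one_mul, hd]
  set I : Finset (Fin n) := univ.filter (fun i => 0 ≤ y i) with hI
  have h1 : ∑ i, |y i| = 2 * ∑ i ∈ I, y i := by
    have e1 := Finset.sum_add_sum_compl I y
    have e2 := Finset.sum_add_sum_compl I (fun i => |y i|)
    have e3 : ∑ i ∈ I, |y i| = ∑ i ∈ I, y i :=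
      Finset.sum_congr rfl fun i hi => abs_of_nonneg (by simpa [hI] using hi)
    have e4 : ∑ i ∈ Iᶜ, |y i| = - ∑ i ∈ Iᶜ, y i := by
      rw [← Finset.sum_neg_distrib]
      refine Finset.sum_congr rfl fun i hi => abs_of_neg (by simpa [hI] using hi)
    linarith
  set P : Fin m → ℝ := fun j => ∑ i ∈ I, Q i j with hP
  have hpair : ∀ j j', P j - P j' ≤ 1 - e := by
    intro j j'
    have := h I j' j
    have h2 := Finset.sum_compl_add_sum I (fun i => Q i j)
    have h2' := Finset.sum_compl_add_sum I (fun i => Q i j')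
    have h3 := h I j j'
    simp only [hQ1] at h2 h2'
    change e ≤ ∑ i ∈ Iᶜ, Q i j + P j' at h3
    change _ + P j = 1 at h2
    linarith
  have h2 : ∑ i ∈ I, y i = ∑ j, P j * d j := by
    simp only [hy, hP]
    rw [Finset.sum_comm]
    simp only [Finset.sum_mul]
  set a : Fin m → ℝ := fun j => max (d j) 0
  set b : Fin m → ℝ := fun j => max (-d j) 0
  have hab : ∀ j, a j - b j = d j := by
    intro j; simp only [a, b]
    rcases le_total 0 (d j) with hh | hh
    · rw [max_eq_left hh, max_eq_right (by linarith)]; ring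
    · rw [max_eq_right hh, max_eq_left (by linarith)]; ring
  have hab' : ∀ j, a j + b j = |d j| := by
    intro j; simp only [a, b]
    rcases le_total 0 (d j) with hh | hh
    · rw [max_eq_left hh, max_eq_right (by linarith), abs_of_nonneg hh]; ring
    · rw [max_eq_right hh, max_eq_left (by linarith), abs_of_nonpos hh]; ring
  have ha : ∀ j, 0 ≤ a j := fun j => le_max_right _ _
  have hb : ∀ j, 0 ≤ b j := fun j => le_max_right _ _
  have sab : ∑ j, a j - ∑ j, b j = 0 := by
    rw [← Finset.sum_sub_distrib]; simp only [hab, hd]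
  have sab' : ∑ j, a j + ∑ j, b j = ∑ j, |d j| := by
    rw [← Finset.sum_add_distrib]; simp only [hab']
  set D := ∑ j, a j with hD
  have hb' : ∑ j, b j = D := by linarith
  have hD0 : 0 ≤ D := Finset.sum_nonneg fun j _ => ha j
  have h3 : D * ∑ j, P j * d j ≤ (1 - e) * D * D := by
    have e1 : ∑ j, ∑ j', a j * b j' * (P j - P j') = D * ∑ j, P j * d j := by
      have e2 : ∀ j, ∑ j', a j * b j' * (P j - P j') =
          D * (a j * P j) - a j * ∑ j', b j' * P j' := by
        intro j
        rw [← hb', Finset.sum_mul, Finset.mul_sum univ (fun j' => b j' * P j'),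
          ← Finset.sum_sub_distrib]
        exact Finset.sum_congr rfl fun _ _ => by ring
      simp only [e2]
      rw [Finset.sum_sub_distrib, ← Finset.mul_sum, ← Finset.sum_mul, ← hD, ← mul_sub,
        ← Finset.sum_sub_distrib]
      congr 1
      exact Finset.sum_congr rfl fun j _ => by rw [← hab j]; ring
    rw [← e1]
    calc ∑ j, ∑ j', a j * b j' * (P j - P j') ≤ ∑ j, ∑ j', a j * b j' * (1 - e) := by
          refine Finset.sum_le_sum fun j _ => Finset.sum_le_sum fun j' _ => ?_
          exact mul_le_mul_of_nonneg_left (hpair j j') (mul_nonneg (ha j) (hb j'))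
      _ = (1 - e) * D * D := by
          simp only [← Finset.sum_mul, ← Finset.mul_sum, hb', ← hD]; ring
  rw [h1, h2, ← sab', hb']
  rcases hD0.eq_or_lt with hz | hz
  · have : ∀ j, d j = 0 := by
      intro j
      have e1 := (Finset.sum_eq_zero_iff_of_nonneg (fun j _ => ha j)).1 hz.symm j (mem_univ _)
      have e2 := (Finset.sum_eq_zero_iff_of_nonneg (fun j _ => hb j)).1 (hb'.trans hz.symm) j
        (mem_univ _)
      rw [← hab, e1, e2, sub_zero]
    simp [this, ← hz]
  · have : ∑ j, P j * d j ≤ (1 - e) * D := by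
      by_contra hh
      push Not at hh
      nlinarith
    linarith

theorem inv_scale_row {n m : ℕ} (A X : Matrix (Fin n) (Fin m) ℝ) (p : Fin n → ℝ)
    (hp : ∀ i, 0 < p i) (h : InvP A X) : InvP A (rowBal p X) := by
  have hnn : ∀ i j, 0 ≤ rowBal p X i j := fun i j =>
    div_nonneg (mul_nonneg (hp i).le (h.nn i j)) (h.row i).le
  refine ⟨hnn, ?_, ?_, ?_⟩
  · intro i
    simp only [rowBal]
    rw [← Finset.sum_div, ← Finset.mul_sum]
    exact div_pos (mul_pos (hp i) (h.row i)) (h.row i)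
  · intro j
    obtain ⟨i, -, hi⟩ := Finset.exists_lt_of_sum_lt (s := univ) (f := fun _ => (0:ℝ))
      (g := fun i => X i j) (by simpa using h.col j)
    exact Finset.sum_pos' (fun i _ => hnn i j)
      ⟨i, mem_univ _, div_pos (mul_pos (hp i) hi) (h.row i)⟩
  · intro i j hh
    simp [rowBal, h.supp i j hh]

theorem inv_scale_col {n m : ℕ} (A X : Matrix (Fin n) (Fin m) ℝ) (q : Fin m → ℝ)
    (hq : ∀ i, 0 < q i) (h : InvP A X) : InvP A (colBal q X) := by
  have hnn : ∀ i j, 0 ≤ colBal q X i j := fun i j =>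
    div_nonneg (mul_nonneg (hq j).le (h.nn i j)) (h.col j).le
  refine ⟨hnn, ?_, ?_, ?_⟩
  · intro i
    obtain ⟨j, -, hj⟩ := Finset.exists_lt_of_sum_lt (s := univ) (f := fun _ => (0:ℝ))
      (g := fun j => X i j) (by simpa using h.row i)
    exact Finset.sum_pos' (fun j _ => hnn i j)
      ⟨j, mem_univ _, div_pos (mul_pos (hq j) hj) (h.col j)⟩
  · intro j
    simp only [colBal]
    rw [← Finset.sum_div, ← Finset.mul_sum]
    exact div_pos (mul_pos (hq j) (h.col j)) (h.col j)
  · intro i j hh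
    simp [colBal, h.supp i j hh]

theorem rowBal_diff {n m : ℕ} (A X : Matrix (Fin n) (Fin m) ℝ) (p : Fin n → ℝ)
    (h : InvP A X) : ∑ i, ∑ j, |rowBal p X i j - X i j| = ∑ i, |(∑ j, X i j) - p i| := by
  refine Finset.sum_congr rfl fun i _ => ?_
  have hr := h.row i
  have : ∀ j, |rowBal p X i j - X i j| = X i j * (|(∑ j, X i j) - p i| / ∑ j, X i j) := by
    intro j
    have : rowBal p X i j - X i j = X i j * ((p i - ∑ j, X i j) / ∑ j, X i j) := by
      simp only [rowBal]; field_simp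
    rw [this, abs_mul, abs_of_nonneg (h.nn i j), abs_div, abs_of_pos hr, abs_sub_comm]
  simp only [this]
  rw [← Finset.sum_mul]
  field_simp

theorem colBal_diff {n m : ℕ} (A X : Matrix (Fin n) (Fin m) ℝ) (q : Fin m → ℝ)
    (h : InvP A X) : ∑ i, ∑ j, |colBal q X i j - X i j| = ∑ j, |(∑ i, X i j) - q j| := by
  rw [Finset.sum_comm]
  refine Finset.sum_congr rfl fun j _ => ?_
  have hr := h.col j
  have : ∀ i, |colBal q X i j - X i j| = X i j * (|(∑ i, X i j) - q j| / ∑ i, X i j) := by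
    intro i
    have : colBal q X i j - X i j = X i j * ((q j - ∑ i, X i j) / ∑ i, X i j) := by
      simp only [colBal]; field_simp
    rw [this, abs_mul, abs_of_nonneg (h.nn i j), abs_div, abs_of_pos hr, abs_sub_comm]
  simp only [this]
  rw [← Finset.sum_mul]
  field_simp

theorem rowBal_row {n m : ℕ} (A X : Matrix (Fin n) (Fin m) ℝ) (p : Fin n → ℝ)
    (h : InvP A X) (i : Fin n) : ∑ j, rowBal p X i j = p i := by
  simp only [rowBal]
  rw [← Finset.sum_div, ← Finset.mul_sum, mul_div_assoc, div_self (h.row i).ne', mul_one]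

theorem colBal_col {n m : ℕ} (A X : Matrix (Fin n) (Fin m) ℝ) (q : Fin m → ℝ)
    (h : InvP A X) (j : Fin m) : ∑ i, colBal q X i j = q j := by
  simp only [colBal]
  rw [← Finset.sum_div, ← Finset.mul_sum, mul_div_assoc, div_self (h.col j).ne', mul_one]

theorem lyap_nonneg' {n m : ℕ} (p : Fin n → ℝ) (q : Fin m → ℝ)
    (X : Matrix (Fin n) (Fin m) ℝ) : 0 ≤ lyap p q X :=
  add_nonneg (Finset.sum_nonneg fun _ _ => abs_nonneg _) (Finset.sum_nonneg fun _ _ => abs_nonneg _)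

theorem lyap_rowBal {n m : ℕ} (A X : Matrix (Fin n) (Fin m) ℝ) (p : Fin n → ℝ) (q : Fin m → ℝ)
    (h : InvP A X) : lyap p q (rowBal p X) ≤ lyap p q X := by
  unfold lyap
  simp only [rowBal_row A X p h, sub_self, abs_zero, Finset.sum_const_zero, zero_add]
  rw [← rowBal_diff A X p h, Finset.sum_comm, ← Finset.sum_add_distrib]
  refine Finset.sum_le_sum fun j _ => ?_
  have : (∑ i, rowBal p X i j) - q j
      = ∑ i, (rowBal p X i j - X i j) + ((∑ i, X i j) - q j) := by
    rw [Finset.sum_sub_distrib]; ring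
  rw [this]
  exact (abs_add_le _ _).trans (add_le_add (Finset.abs_sum_le_sum_abs _ _) le_rfl)

theorem lyap_colBal {n m : ℕ} (A X : Matrix (Fin n) (Fin m) ℝ) (p : Fin n → ℝ) (q : Fin m → ℝ)
    (h : InvP A X) (hr : ∀ i, ∑ j, X i j = p i) (hbal : ∑ i, p i = ∑ j, q j) (e : ℝ)
    (hg : GoodP X e) :
    lyap p q (colBal q X) ≤ (1 - e) * lyap p q X := by
  have hd : ∑ j, (q j - ∑ i, X i j) = 0 := by
    rw [Finset.sum_sub_distrib, Finset.sum_comm]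
    simp only [hr, hbal, sub_self]
  have := dobrushin X e h.col hg (fun j => q j - ∑ i, X i j) hd
  unfold lyap
  simp only [colBal_col A X q h, hr, sub_self, abs_zero, Finset.sum_const_zero, zero_add, add_zero]
  have e1 : ∀ i, (∑ j, colBal q X i j) - p i =
      ∑ j, X i j / (∑ k, X k j) * (q j - ∑ i, X i j) := by
    intro i
    rw [← hr i, ← Finset.sum_sub_distrib]
    refine Finset.sum_congr rfl fun j _ => ?_
    have := (h.col j).ne'
    simp only [colBal]
    field_simp
  have e2 : ∀ j, |(∑ i, X i j) - q j| = |q j - ∑ i, X i j| := fun j => abs_sub_comm _ _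
  simp only [e1, e2]
  exact this

theorem goodP_le_one {n m : ℕ} (X : Matrix (Fin n) (Fin m) ℝ) (e : ℝ) (j : Fin m)
    (hc : ∀ j, 0 < ∑ i, X i j) (h : GoodP X e) : e ≤ 1 := by
  have := h ∅ j j
  simpa [sum_frac_one X j (hc j)] using this

theorem step_main {n m : ℕ} (A X : Matrix (Fin n) (Fin m) ℝ) (p : Fin n → ℝ) (q : Fin m → ℝ)
    (j0 : Fin m)
    (hp : ∀ i, 0 < p i) (hq : ∀ j, 0 < q j) (hbal : ∑ i, p i = ∑ j, q j)
    (h : InvP A X) (e pm : ℝ) (hpm : 0 < pm) (hpm' : ∀ i, pm ≤ p i)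
    (hw : lyap p q X / pm < 1) (hg : GoodP X e) :
    InvP A (colBal q (rowBal p X)) ∧
    GoodP (colBal q (rowBal p X)) ((1 - lyap p q X / pm) * e) ∧
    lyap p q (colBal q (rowBal p X)) ≤ (1 - (1 - lyap p q X / pm) * e) * lyap p q X ∧
    (∀ i j, |colBal q (rowBal p X) i j - X i j| ≤ 2 * lyap p q X) := by
  have hR := inv_scale_row A X p hp h
  have hC := inv_scale_col A _ q hq hR
  have hV := lyap_nonneg' p q X
  have hreq : rowBal p X = fun i j => (p i / ∑ l, X i l) * X i j := by
    funext i j; simp only [rowBal]; ring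
  have hgR : GoodP (rowBal p X) ((1 - lyap p q X / pm) * e) := by
    have hcol := hR.col
    rw [hreq] at hcol ⊢
    refine goodP_scale X e _ _ h.nn h.col (by linarith) (fun i => div_pos (hp i) (h.row i))
      ?_ hcol hg
    intro i i'
    rw [mul_div_assoc', div_le_div_iff₀ (h.row i) (h.row i')]
    have hw0 : 0 ≤ lyap p q X / pm := div_nonneg hV hpm.le
    by_cases hii : i = i'
    · subst hii
      have := mul_pos (hp i) (h.row i)
      nlinarith
    have hsum : |(∑ j, X i j) - p i| + |(∑ j, X i' j) - p i'| ≤ lyap p q X := by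
      have h1 : ∑ k ∈ ({i, i'} : Finset (Fin n)), |(∑ j, X k j) - p k| ≤
          ∑ k, |(∑ j, X k j) - p k| :=
        Finset.sum_le_sum_of_subset_of_nonneg (Finset.subset_univ _) fun _ _ _ => abs_nonneg _
      rw [Finset.sum_pair hii] at h1
      have h2 : 0 ≤ ∑ j, |(∑ i, X i j) - q j| := Finset.sum_nonneg fun _ _ => abs_nonneg _
      unfold lyap
      linarith
    set R := ∑ j, X i j
    set R' := ∑ j, X i' j
    set a := |R - p i| / pm with ha
    set b := |R' - p i'| / pm with hb
    have hab : a + b ≤ lyap p q X / pm := by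
      rw [ha, hb, ← add_div]; exact div_le_div_of_nonneg_right hsum hpm.le
    have ha0 : 0 ≤ a := div_nonneg (abs_nonneg _) hpm.le
    have hb0 : 0 ≤ b := div_nonneg (abs_nonneg _) hpm.le
    have ha1 : |R - p i| = a * pm := by rw [ha]; field_simp
    have hb1 : |R' - p i'| = b * pm := by rw [hb]; field_simp
    have hRl : (1 - a) * p i ≤ R := by
      have := neg_abs_le (R - p i)
      nlinarith [hpm' i]
    have hRu : R' ≤ (1 + b) * p i' := by
      have := le_abs_self (R' - p i')
      nlinarith [hpm' i']
    have hk : (1 - lyap p q X / pm) * (1 + b) ≤ 1 - a := by nlinarith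
    have hpp := mul_pos (hp i) (hp i')
    calc (1 - lyap p q X / pm) * p i * R' ≤ (1 - lyap p q X / pm) * p i * ((1 + b) * p i') := by
          refine mul_le_mul_of_nonneg_left hRu (mul_nonneg (by linarith) (hp i).le)
      _ = ((1 - lyap p q X / pm) * (1 + b)) * (p i * p i') := by ring
      _ ≤ (1 - a) * (p i * p i') := mul_le_mul_of_nonneg_right hk hpp.le
      _ = p i' * ((1 - a) * p i) := by ring
      _ ≤ p i' * R := mul_le_mul_of_nonneg_left hRl (hp i').le
  have hle := goodP_le_one _ _ j0 hR.col hgR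
  have hL := lyap_rowBal A X p q h
  refine ⟨hC, goodP_colBal _ _ q hR.col hq hgR, ?_, ?_⟩
  · refine (lyap_colBal A _ p q hR (rowBal_row A X p h) hbal _ hgR).trans ?_
    exact mul_le_mul_of_nonneg_left hL (by linarith)
  · intro i j
    have key : ∀ (Z : Fin n → Fin m → ℝ), |Z i j| ≤ ∑ i, ∑ j, |Z i j| := by
      intro Z
      refine le_trans ?_ (Finset.single_le_sum (f := fun i => ∑ j, |Z i j|)
        (fun i _ => Finset.sum_nonneg fun j _ => abs_nonneg _) (mem_univ i))
      exact Finset.single_le_sum (f := fun j => |Z i j|) (fun j _ => abs_nonneg _) (mem_univ j)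
    have h1 := key (fun i j => rowBal p X i j - X i j)
    have h2 := key (fun i j => colBal q (rowBal p X) i j - rowBal p X i j)
    rw [rowBal_diff A X p h] at h1
    rw [colBal_diff A _ q hR] at h2
    have h3 : ∑ i, |(∑ j, X i j) - p i| ≤ lyap p q X :=
      le_add_of_nonneg_right (Finset.sum_nonneg fun _ _ => abs_nonneg _)
    have h4 : ∑ j, |(∑ i, rowBal p X i j) - q j| ≤ lyap p q (rowBal p X) :=
      le_add_of_nonneg_left (Finset.sum_nonneg fun _ _ => abs_nonneg _)
    have h5 := abs_add_le (colBal q (rowBal p X) i j - rowBal p X i j) (rowBal p X i j - X i j)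
    rw [sub_add_sub_cancel] at h5
    linarith

theorem iter_two {n m : ℕ} (p : Fin n → ℝ) (q : Fin m → ℝ) (A : Matrix (Fin n) (Fin m) ℝ) (t : ℕ) :
    iterBal p q A (2 * (t + 1)) = colBal q (rowBal p (iterBal p q A (2 * t))) := by
  rw [show 2 * (t + 1) = 2 * t + 1 + 1 by ring]
  rw [iterBal, if_neg (by omega), iterBal, if_pos (by omega)]

theorem iter_bounds {n m : ℕ} (A : Matrix (Fin n) (Fin m) ℝ) (p : Fin n → ℝ) (q : Fin m → ℝ)
    (j0 : Fin m)
    (hp : ∀ i, 0 < p i) (hq : ∀ j, 0 < q j) (hbal : ∑ i, p i = ∑ j, q j)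
    (h : InvP A A) (e pm w : ℝ) (hpm : 0 < pm) (hpm' : ∀ i, pm ≤ p i)
    (hw : w = lyap p q A / pm) (hw1 : w < 1) (hg : GoodP A e) (hD : w < e * (1 - w)) (t : ℕ) :
    InvP A (iterBal p q A (2 * t)) ∧
    lyap p q (iterBal p q A (2 * t)) ≤ (1 - (e - w / (1 - w))) ^ t * lyap p q A ∧
    lyap p q (iterBal p q A (2 * t)) / pm ≤ w ∧
    ∃ e', GoodP (iterBal p q A (2 * t)) e' ∧
      e * (1 - w) - w ≤ e' * (1 - w) - lyap p q (iterBal p q A (2 * t)) / pm := by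
  induction t with
  | zero => exact ⟨h, by simp [iterBal], by simp [iterBal, hw], e, hg, by simp [iterBal, hw]⟩
  | succ t ih =>
    obtain ⟨h1, h2, h3, e', h4, h5⟩ := ih
    rw [iter_two]
    set X := iterBal p q A (2 * t)
    obtain ⟨g1, g2, g3, -⟩ := step_main A X p q j0 hp hq hbal h1 e' pm hpm hpm' (by linarith) h4
    have hV := lyap_nonneg' p q X
    have hV' := lyap_nonneg' p q (colBal q (rowBal p X))
    set Y := colBal q (rowBal p X)
    set u := lyap p q X / pm with hu
    set e2 := (1 - u) * e' with he2
    have hu0 : 0 ≤ u := div_nonneg hV hpm.le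
    have hu' : 0 ≤ lyap p q Y / pm := div_nonneg hV' hpm.le
    have g3' : lyap p q Y / pm ≤ (1 - e2) * u := by
      rw [hu, mul_div_assoc']; exact div_le_div_of_nonneg_right g3 hpm.le
    have he' : 0 < e' := by
      by_contra hh; push Not at hh; nlinarith
    have h6 : e * (1 - w) - w ≤ e2 * (1 - w) - lyap p q Y / pm := by
      have : 0 ≤ e' * u * (w - u) := mul_nonneg (mul_nonneg he'.le hu0) (by linarith)
      have h7 : e2 * (1 - w) - (1 - e2) * u = e' * (1 - w) - u + e' * u * (w - u) := by
        rw [he2]; ring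
      linarith
    have h8 : e - w / (1 - w) ≤ e2 := by
      have : e - w / (1 - w) = (e * (1 - w) - w) / (1 - w) := by
        have : 1 - w ≠ 0 := by linarith
        field_simp
      rw [this, div_le_iff₀ (by linarith)]
      linarith
    have h9 : e2 ≤ 1 := goodP_le_one _ _ j0 g1.col g2
    have h10 : 0 ≤ e2 := by
      rw [he2]; exact mul_nonneg (by linarith) he'.le
    refine ⟨g1, ?_, ?_, e2, g2, h6⟩
    · rw [pow_succ', mul_assoc]
      refine g3.trans ?_
      refine (mul_le_mul_of_nonneg_right (by linarith) hV).trans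
        (mul_le_mul_of_nonneg_left h2 (by linarith))
    · nlinarith

theorem params (w e : ℝ) (hw0 : 0 < w) (hw1 : w < 1) (he : 0 < e) (hw2 : e < (1 + w) / (1 - w))
    (hw3 : 2 * w * (1 + w * rF w e) ≤ e) : w < min e 1 * (1 - w) := by
  have h1 : 0 < 1 - w := by linarith
  rw [lt_div_iff₀ h1] at hw2
  have hr : 2 ≤ rF w e * (1 - w) := by
    unfold rF
    rw [show 1 + e * w - (1 + e) * w ^ 2 = (1 - w) * (1 + (1 + e) * w) by ring]
    have h2 : 0 < (1 + (1 + e) * w) := by positivity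
    rw [div_mul_eq_mul_div, le_div_iff₀ (by positivity)]
    have : 2 * ((1 - w) * (1 + (1 + e) * w)) ≤ 4 - (1 + e) * (1 - w) ^ 2 := by nlinarith
    nlinarith
  have h3 : 2 * w * (1 + w) ≤ e * (1 - w) := by
    have := mul_le_mul_of_nonneg_right hw3 h1.le
    nlinarith [mul_pos hw0 hw0]
  have h4 : 2 * w < 1 := by nlinarith
  rcases le_total e 1 with hh | hh
  · rw [min_eq_left hh]; nlinarith
  · rw [min_eq_right hh]; linarith

theorem frob_sq {n m : ℕ} (X : Matrix (Fin n) (Fin m) ℝ) : frob X ^ 2 = ∑ i, ∑ j, X i j ^ 2 :=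
  Real.sq_sqrt (Finset.sum_nonneg fun _ _ => Finset.sum_nonneg fun _ _ => sq_nonneg _)

theorem frob_nonneg {n m : ℕ} (X : Matrix (Fin n) (Fin m) ℝ) : 0 ≤ frob X := Real.sqrt_nonneg _

noncomputable def ipr {n m : ℕ} (X Y : Matrix (Fin n) (Fin m) ℝ) : ℝ := ∑ i, ∑ j, X i j * Y i j

theorem frob_add_smul {n m : ℕ} (X Y : Matrix (Fin n) (Fin m) ℝ) (c : ℝ) :
    frob (X + c • Y) ^ 2 = frob X ^ 2 + 2 * c * ipr Y X + c ^ 2 * frob Y ^ 2 := by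
  simp only [frob_sq, ipr, Finset.mul_sum, ← Finset.sum_add_distrib]
  refine Finset.sum_congr rfl fun i _ => Finset.sum_congr rfl fun j _ => ?_
  simp only [Matrix.add_apply, Matrix.smul_apply, smul_eq_mul]; ring

theorem frob_add_sq {n m : ℕ} (X Y : Matrix (Fin n) (Fin m) ℝ) :
    frob (X + Y) ^ 2 = frob X ^ 2 + 2 * ipr Y X + frob Y ^ 2 := by
  have := frob_add_smul X Y 1
  simpa using this

theorem ipr_sub {n m : ℕ} (X Y Z : Matrix (Fin n) (Fin m) ℝ) :
    ipr (X - Y) Z = ipr X Z - ipr Y Z := by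
  simp only [ipr, ← Finset.sum_sub_distrib]
  refine Finset.sum_congr rfl fun i _ => Finset.sum_congr rfl fun j _ => ?_
  simp only [Matrix.sub_apply]; ring

theorem abs_le_frob {n m : ℕ} (X : Matrix (Fin n) (Fin m) ℝ) (i : Fin n) (j : Fin m) :
    |X i j| ≤ frob X := by
  apply Real.abs_le_sqrt
  refine le_trans ?_ (Finset.single_le_sum (f := fun i => ∑ j, X i j ^ 2)
        (fun i _ => Finset.sum_nonneg fun j _ => sq_nonneg _) (mem_univ i))
  exact Finset.single_le_sum (f := fun j => X i j ^ 2) (fun j _ => sq_nonneg _) (mem_univ j)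

theorem ipr_le {n m : ℕ} (X Y : Matrix (Fin n) (Fin m) ℝ) (c : ℝ) (hX : ∀ i j, |X i j| ≤ c) :
    ipr X Y ≤ (n * m * c) * frob Y := by
  calc ipr X Y ≤ ∑ _i : Fin n, ∑ _j : Fin m, c * frob Y := by
        refine Finset.sum_le_sum fun i _ => Finset.sum_le_sum fun j _ => ?_
        refine (le_abs_self _).trans ?_
        rw [abs_mul]
        exact mul_le_mul (hX i j) (abs_le_frob Y i j) (abs_nonneg _)
          ((abs_nonneg _).trans (hX i j))
    _ = _ := by simp; ring

theorem Xhat_row {n m : ℕ} (hn : 2 ≤ n) (hm : 2 ≤ m) (A : Matrix (Fin n) (Fin m) ℝ) (p : Fin n → ℝ)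
    (q : Fin m → ℝ) (hbal : ∑ i, p i = ∑ j, q j) (i : Fin n) : ∑ j, Xhat A p q i j = p i := by
  have hn' : (n : ℝ) ≠ 0 := by positivity
  have hm' : (m : ℝ) ≠ 0 := by positivity
  simp only [Xhat, Finset.sum_add_distrib, Finset.sum_sub_distrib, ← Finset.mul_sum,
    Finset.sum_const, Finset.card_univ, Fintype.card_fin, nsmul_eq_mul, hbal]
  rw [Finset.sum_comm (f := fun j i => A i j)]
  field_simp
  ring

theorem Xhat_col {n m : ℕ} (hn : 2 ≤ n) (hm : 2 ≤ m) (A : Matrix (Fin n) (Fin m) ℝ) (p : Fin n → ℝ)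
    (q : Fin m → ℝ) (j : Fin m) : ∑ i, Xhat A p q i j = q j := by
  have hn' : (n : ℝ) ≠ 0 := by positivity
  have hm' : (m : ℝ) ≠ 0 := by positivity
  simp only [Xhat, Finset.sum_add_distrib, Finset.sum_sub_distrib, ← Finset.mul_sum,
    Finset.sum_const, Finset.card_univ, Fintype.card_fin, nsmul_eq_mul]
  field_simp
  ring

theorem ipr_sep {n m : ℕ} (D : Matrix (Fin n) (Fin m) ℝ) (a : Fin n → ℝ) (b : Fin m → ℝ)
    (hr : ∀ i, ∑ j, D i j = 0) (hc : ∀ j, ∑ i, D i j = 0) :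
    ipr D (fun i j => a i + b j : Matrix (Fin n) (Fin m) ℝ) = 0 := by
  simp only [ipr, mul_add, Finset.sum_add_distrib]
  rw [Finset.sum_comm (f := fun i j => D i j * b j)]
  simp only [← Finset.sum_mul, hr, hc]
  simp

theorem Xhat_opt {n m : ℕ} (hn : 2 ≤ n) (hm : 2 ≤ m) (A X : Matrix (Fin n) (Fin m) ℝ)
    (p : Fin n → ℝ) (q : Fin m → ℝ) (hbal : ∑ i, p i = ∑ j, q j)
    (h1 : ∀ i, ∑ j, X i j = p i) (h2 : ∀ j, ∑ i, X i j = q j) :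
    frob (Xhat A p q - A) ^ 2 ≤ frob (X - A) ^ 2 := by
  have hd : X - A = (Xhat A p q - A) + (X - Xhat A p q) := by abel
  have hs : Xhat A p q - A = (fun i j => (-(1 / (m : ℝ)) * ((∑ l, A i l) - p i)) +
      (- (1 / (n : ℝ)) * ((∑ k, A k j) - q j)
      + (1 / ((n : ℝ) * (m : ℝ))) * ((∑ k, ∑ l, A k l) - ∑ i, p i)) :
        Matrix (Fin n) (Fin m) ℝ) := by
    funext i j
    simp only [Matrix.sub_apply, Xhat]; ring
  have h0 : ipr (X - Xhat A p q) (Xhat A p q - A) = 0 := by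
    rw [hs]
    refine ipr_sep _ _ (fun j => - (1 / (n : ℝ)) * ((∑ k, A k j) - q j)
      + (1 / ((n : ℝ) * (m : ℝ))) * ((∑ k, ∑ l, A k l) - ∑ i, p i)) ?_ ?_
    · intro i
      simp only [Matrix.sub_apply, Finset.sum_sub_distrib, h1, Xhat_row hn hm A p q hbal, sub_self]
    · intro j
      simp only [Matrix.sub_apply, Finset.sum_sub_distrib, h2, Xhat_col hn hm A p q, sub_self]
  rw [hd, frob_add_sq, h0]
  nlinarith [sq_nonneg (frob (X - Xhat A p q))]

theorem Xhat_pos {n m : ℕ} (hn : 2 ≤ n) (hm : 2 ≤ m) (A : Matrix (Fin n) (Fin m) ℝ)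
    (p : Fin n → ℝ) (q : Fin m → ℝ) (hbal : ∑ i, p i = ∑ j, q j) (hV : 0 < lyap p q A) :
    0 < frob (Xhat A p q - A) := by
  rcases (frob_nonneg (Xhat A p q - A)).eq_or_lt with hz | hz
  · exfalso
    have : ∀ i j, A i j = Xhat A p q i j := by
      intro i j
      have := abs_le_frob (Xhat A p q - A) i j
      rw [← hz] at this
      have := abs_nonpos_iff.1 this
      simp only [Matrix.sub_apply] at this
      linarith
    have h1 : ∀ i, ∑ j, A i j = p i := fun i => by
      rw [← Xhat_row hn hm A p q hbal i]; exact Finset.sum_congr rfl fun j _ => this i j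
    have h2 : ∀ j, ∑ i, A i j = q j := fun j => by
      rw [← Xhat_col hn hm A p q j]; exact Finset.sum_congr rfl fun i _ => this i j
    simp [lyap, h1, h2] at hV
  · exact hz

theorem var_ineq {n m : ℕ} (G D : Matrix (Fin n) (Fin m) ℝ)
    (h : ∀ c : ℝ, 0 < c → c ≤ 1 → frob G ≤ frob (G + c • D)) : 0 ≤ ipr D G := by
  by_contra hh
  push Not at hh
  set x := ipr D G
  set N := frob D ^ 2 with hN
  have hN0 : 0 ≤ N := sq_nonneg _
  have key : ∀ c : ℝ, 0 < c → c ≤ 1 → 0 ≤ 2 * x + c * N := by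
    intro c hc hc1
    have h1 := pow_le_pow_left₀ (frob_nonneg G) (h c hc hc1) 2
    rw [frob_add_smul] at h1
    have h2 : 0 ≤ c * (2 * x + c * N) := by
      have : c * (2 * x + c * N) = 2 * c * x + c ^ 2 * N := by ring
      rw [this]; linarith
    exact nonneg_of_mul_nonneg_right h2 hc
  have hpos : 0 < N - x := by linarith
  have h3 := key (-x / (N - x)) (div_pos (by linarith) hpos) (by rw [div_le_one hpos]; linarith)
  have h4 : -x / (N - x) * N ≤ -x := by
    rw [div_mul_eq_mul_div, div_le_iff₀ hpos]
    nlinarith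
  linarith

theorem limit_exists {n m : ℕ} (A : Matrix (Fin n) (Fin m) ℝ) (p : Fin n → ℝ) (q : Fin m → ℝ)
    (X : ℕ → Matrix (Fin n) (Fin m) ℝ) (r V : ℝ) (hr0 : 0 ≤ r) (hr : r < 1)
    (hI : ∀ t, InvP A (X t)) (hL : ∀ t, lyap p q (X t) ≤ r ^ t * V)
    (hs : ∀ t i j, |X (t + 1) i j - X t i j| ≤ 2 * lyap p q (X t)) :
    ∃ Y : Matrix (Fin n) (Fin m) ℝ, (∀ i, ∑ j, Y i j = p i) ∧ (∀ j, ∑ i, Y i j = q j) ∧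
      (∀ i j, 0 ≤ Y i j) ∧ (∀ i j, A i j = 0 → Y i j = 0) ∧
      ∀ t i j, |X t i j - Y i j| ≤ 2 * V * r ^ t / (1 - r) := by
  have hd : ∀ i j t, dist (X t i j) (X (t + 1) i j) ≤ 2 * V * r ^ t := by
    intro i j t
    rw [dist_comm, Real.dist_eq]
    linarith [hs t i j, hL t]
  have hex : ∀ i j, ∃ y, Filter.Tendsto (fun t => X t i j) Filter.atTop (nhds y) := fun i j =>
    cauchySeq_tendsto_of_complete (cauchySeq_of_le_geometric r (2 * V) hr (hd i j))
  choose Y hY using hex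
  have hlim : Filter.Tendsto (fun t => r ^ t * V) Filter.atTop (nhds 0) := by
    simpa using (tendsto_pow_atTop_nhds_zero_of_lt_one hr0 hr).mul_const V
  have hlim' : Filter.Tendsto (fun t => lyap p q (X t)) Filter.atTop (nhds 0) :=
    squeeze_zero (fun t => lyap_nonneg' p q _) hL hlim
  refine ⟨Y, ?_, ?_, ?_, ?_, ?_⟩
  · intro i
    have h1 : Filter.Tendsto (fun t => ∑ j, X t i j) Filter.atTop (nhds (∑ j, Y i j)) :=
      tendsto_finsetSum _ fun j _ => hY i j
    have h2 : Filter.Tendsto (fun t => (∑ j, X t i j) - p i) Filter.atTop (nhds 0) := by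
      refine squeeze_zero_norm (fun t => ?_) hlim'
      rw [Real.norm_eq_abs]
      exact (Finset.single_le_sum (f := fun i => |(∑ j, X t i j) - p i|)
        (fun _ _ => abs_nonneg _) (mem_univ i)).trans
        (le_add_of_nonneg_right (Finset.sum_nonneg fun _ _ => abs_nonneg _))
    have := tendsto_nhds_unique h2 (h1.sub_const (p i))
    linarith
  · intro j
    have h1 : Filter.Tendsto (fun t => ∑ i, X t i j) Filter.atTop (nhds (∑ i, Y i j)) :=
      tendsto_finsetSum _ fun i _ => hY i j
    have h2 : Filter.Tendsto (fun t => (∑ i, X t i j) - q j) Filter.atTop (nhds 0) := by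
      refine squeeze_zero_norm (fun t => ?_) hlim'
      rw [Real.norm_eq_abs]
      exact (Finset.single_le_sum (f := fun j => |(∑ i, X t i j) - q j|)
        (fun _ _ => abs_nonneg _) (mem_univ j)).trans
        (le_add_of_nonneg_left (Finset.sum_nonneg fun _ _ => abs_nonneg _))
    have := tendsto_nhds_unique h2 (h1.sub_const (q j))
    linarith
  · intro i j
    exact ge_of_tendsto' (hY i j) fun t => (hI t).nn i j
  · intro i j hA
    refine tendsto_nhds_unique (hY i j) ?_
    have : (fun t => X t i j) = fun _ => 0 := funext fun t => (hI t).supp i j hA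
    rw [this]; exact tendsto_const_nhds
  · intro t i j
    rw [← Real.dist_eq]
    exact dist_le_of_le_geometric_of_tendsto r (2 * V) hr (hd i j) (hY i j) t

set_option maxHeartbeats 1000000 in
/-- Corollary 2: distance between the even iterates and the exact solution `X*` of the
constrained problem. -/
theorem distance_to_exact_solution_bound
    {n m : ℕ} (hn : 2 ≤ n) (hm : 2 ≤ m)
    (A : Matrix (Fin n) (Fin m) ℝ) (p : Fin n → ℝ) (q : Fin m → ℝ)
    (hA : ∀ i j, 0 ≤ A i j)
    (hrow : ∀ i, ∃ j, A i j ≠ 0)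
    (hcol : ∀ j, ∃ i, A i j ≠ 0)
    (hp : ∀ i, 0 < p i) (hq : ∀ j, 0 < q j)
    (hbal : ∑ i, p i = ∑ j, q j)
    (heps : 0 < epsP A)
    (hw1 : lyap p q A / (⨅ i, p i) < 1)
    (hw2 : epsP A < (1 + lyap p q A / (⨅ i, p i)) / (1 - lyap p q A / (⨅ i, p i)))
    (hw3 : 2 * (lyap p q A / (⨅ i, p i)) *
        (1 + (lyap p q A / (⨅ i, p i)) * rF (lyap p q A / (⨅ i, p i)) (epsP A)) ≤ epsP A)
    (hV : 0 < lyap p q A)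
    (Xstar : Matrix (Fin n) (Fin m) ℝ)
    (hXs1 : ∀ i, ∑ j, Xstar i j = p i) (hXs2 : ∀ j, ∑ i, Xstar i j = q j)
    (hXs3 : ∀ i j, 0 ≤ Xstar i j) (hXs4 : ∀ i j, A i j = 0 → Xstar i j = 0)
    (hXsMin : ∀ Y : Matrix (Fin n) (Fin m) ℝ,
      (∀ i, ∑ j, Y i j = p i) → (∀ j, ∑ i, Y i j = q j) → (∀ i j, 0 ≤ Y i j) →
      (∀ i j, A i j = 0 → Y i j = 0) → frob (Xstar - A) ≤ frob (Y - A))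
    (hXsUnique : ∀ Y : Matrix (Fin n) (Fin m) ℝ,
      (∀ i, ∑ j, Y i j = p i) → (∀ j, ∑ i, Y i j = q j) → (∀ i j, 0 ≤ Y i j) →
      (∀ i j, A i j = 0 → Y i j = 0) → frob (Y - A) ≤ frob (Xstar - A) → Y = Xstar) :
    ∃ α : ℝ, 0 < α ∧ α < 1 ∧ ∀ t : ℕ,
      frob (iterBal p q A (2 * t) - Xstar) ^ 2 ≤
        frob (Xstar - A) ^ 2 * deltaJ A p q (iterBal p q A (2 * t)) *
          (2 + deltaJ A p q (iterBal p q A (2 * t))) +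
        frob (Xstar - A) * (4 * lyap p q A / α) * (1 - α) ^ (2 * t) := by
  have hn0 : 0 < n := by omega
  have hm0 : 0 < m := by omega
  haveI : Nonempty (Fin n) := ⟨⟨0, hn0⟩⟩
  let j0 : Fin m := ⟨0, hm0⟩
  set pm := ⨅ i, p i with hpmdef
  have hpm' : ∀ i, pm ≤ p i := fun i => ciInf_le (Set.finite_range p).bddBelow i
  have hpm : 0 < pm := by
    obtain ⟨i, hi⟩ := exists_eq_ciInf_of_finite (f := p)
    rw [hpmdef, ← hi]; exact hp i
  have hInv : InvP A A := by
    refine ⟨hA, ?_, ?_, fun _ _ h => h⟩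
    · intro i
      obtain ⟨j, hj⟩ := hrow i
      exact Finset.sum_pos' (fun j _ => hA i j) ⟨j, mem_univ _, (hA i j).lt_of_ne' hj⟩
    · intro j
      obtain ⟨i, hi⟩ := hcol j
      exact Finset.sum_pos' (fun i _ => hA i j) ⟨i, mem_univ _, (hA i j).lt_of_ne' hi⟩
  set w := lyap p q A / pm with hw
  have hw0 : 0 < w := div_pos hV hpm
  set e := min (epsP A) 1 with he
  have hD : w < e * (1 - w) := params w _ hw0 hw1 heps hw2 hw3
  have hgood : GoodP A e := goodP_of_eps A hInv
  have hB := iter_bounds A p q j0 hp hq hbal hInv e pm w hpm hpm' hw hw1 hgood hD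
  set η := e - w / (1 - w) with hη
  have h1w : 0 < 1 - w := by linarith
  have hη0 : 0 < η := by
    have : w / (1 - w) < e := by rw [div_lt_iff₀ h1w]; exact hD
    linarith
  have hη1 : η < 1 := by
    have : e ≤ 1 := min_le_right _ _
    have : 0 < w / (1 - w) := div_pos hw0 h1w
    linarith
  obtain ⟨Y, hY1, hY2, hY3, hY4, hY5⟩ := limit_exists A p q (fun t => iterBal p q A (2 * t))
    (1 - η) (lyap p q A) (by linarith) (by linarith) (fun t => (hB t).1) (fun t => (hB t).2.1) (by
      intro t i j
      obtain ⟨h1, h2, h3, e', h4, -⟩ := hB t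
      simp only [iter_two]
      exact (step_main A _ p q j0 hp hq hbal h1 e' pm hpm hpm' (by linarith) h4).2.2.2 i j)
  have hvar : 0 ≤ ipr (Y - Xstar) (Xstar - A) := by
    apply var_ineq
    intro c hc hc1
    have h1 := hXsMin (Xstar + c • (Y - Xstar))
    rw [show Xstar + c • (Y - Xstar) - A = Xstar - A + c • (Y - Xstar) by abel] at h1
    apply h1
    · intro i
      simp only [Matrix.add_apply, Matrix.smul_apply, Matrix.sub_apply, smul_eq_mul,
        Finset.sum_add_distrib, ← Finset.mul_sum, Finset.sum_sub_distrib, hXs1, hY1]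
      ring
    · intro j
      simp only [Matrix.add_apply, Matrix.smul_apply, Matrix.sub_apply, smul_eq_mul,
        Finset.sum_add_distrib, ← Finset.mul_sum, Finset.sum_sub_distrib, hXs2, hY2]
      ring
    · intro i j
      simp only [Matrix.add_apply, Matrix.smul_apply, Matrix.sub_apply, smul_eq_mul]
      nlinarith [hXs3 i j, hY3 i j]
    · intro i j h
      simp [hXs4 i j h, hY4 i j h]
  have hJp := Xhat_pos hn hm A p q hbal hV
  have hJo := Xhat_opt hn hm A Xstar p q hbal hXs1 hXs2
  set Jh := frob (Xhat A p q - A) with hJh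
  set Js := frob (Xstar - A) with hJs
  have hJs0 : 0 ≤ Js := frob_nonneg _
  have hnm1 : (1 : ℝ) ≤ n * m := by
    have : 1 ≤ n * m := Nat.mul_pos hn0 hm0
    exact_mod_cast this
  have hnm0 : (0 : ℝ) < n * m := by linarith
  set N : ℝ := n * m with hN
  refine ⟨η / (2 * N), by positivity, ?_, ?_⟩
  · rw [div_lt_one (by positivity)]; linarith
  intro t
  set X := iterBal p q A (2 * t) with hX
  set α := η / (2 * N) with hα
  have hα0 : 0 < α := by positivity
  have hα2 : 2 * α ≤ η := by
    rw [hα, mul_div_assoc', div_le_iff₀ (by positivity)]; nlinarith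
  have hpow : (1 - η) ^ t ≤ (1 - α) ^ (2 * t) := by
    rw [pow_mul]
    refine pow_le_pow_left₀ (by linarith) ?_ t
    nlinarith [sq_nonneg α]
  -- expansion
  have hexp : frob (X - A) ^ 2 = Js ^ 2 + 2 * ipr (X - Xstar) (Xstar - A)
      + frob (X - Xstar) ^ 2 := by
    rw [hJs, ← frob_add_sq]
    congr 2; abel
  have hin : ipr (Y - X) (Xstar - A) ≤ (N * (2 * lyap p q A * (1 - η) ^ t / η)) * Js := by
    rw [hN]
    refine ipr_le _ _ _ ?_
    intro i j
    have := hY5 t i j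
    rw [sub_sub_cancel] at this
    rw [Matrix.sub_apply, abs_sub_comm]
    exact this
  have hsplit : ipr (Y - Xstar) (Xstar - A) - ipr (X - Xstar) (Xstar - A)
      = ipr (Y - X) (Xstar - A) := by
    simp only [ipr_sub]; ring
  have hδ : frob (X - A) ^ 2 - Js ^ 2 ≤ Js ^ 2 * deltaJ A p q X * (2 + deltaJ A p q X) := by
    have h1 : deltaJ A p q X = frob (X - A) / Jh - 1 := by
      unfold deltaJ
      rw [← hJh, sub_div, div_self hJp.ne']
    have h2 : Js ^ 2 * deltaJ A p q X * (2 + deltaJ A p q X)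
        = (Js ^ 2 / Jh ^ 2) * frob (X - A) ^ 2 - Js ^ 2 := by
      rw [h1]; field_simp; ring
    rw [h2]
    have h3 : 1 ≤ Js ^ 2 / Jh ^ 2 := by
      rw [le_div_iff₀ (by positivity)]; linarith
    nlinarith [sq_nonneg (frob (X - A))]
  have hfin : 2 * ((N * (2 * lyap p q A * (1 - η) ^ t / η)) * Js) ≤
      Js * (4 * lyap p q A / α) * (1 - α) ^ (2 * t) := by
    have h1 : 2 * ((N * (2 * lyap p q A * (1 - η) ^ t / η)) * Js)
        = (Js * (4 * lyap p q A * N / η)) * (1 - η) ^ t := by ring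
    have h2 : 4 * lyap p q A / α = 2 * (4 * lyap p q A * N / η) := by
      rw [hα]; field_simp
    have h3 : 0 ≤ Js * (4 * lyap p q A * N / η) := by positivity
    rw [h1, h2]
    have h4 : 0 ≤ (1 - η) ^ t := pow_nonneg (by linarith) t
    have h5 := mul_le_mul_of_nonneg_left hpow h3
    refine h5.trans ?_
    rw [show Js * (2 * (4 * lyap p q A * N / η)) = 2 * (Js * (4 * lyap p q A * N / η)) by ring]
    refine mul_le_mul_of_nonneg_right ?_ (h4.trans hpow)
    linarith
  linarith
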